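/- arXiv:quant-ph/0412001 — 2 statements merged into one kernel-verified Lean document; each statement's English description precedes it below -/
import Mathlib

section
/- Let d ≥ 2 and let U be a d×d unitary matrix that normalizes the generalized Pauli group, i.e. U W(d) U† = W(d). Then there exist a 2×2 integer matrix F with det F ≡ 1 (mod d̄) and a vector χ ∈ ℤ² such that U D_p U† = ω^{⟨χ, Fp⟩} D_{Fp} for all p ∈ ℤ². -/
noncomputable section
open Matrix Complex

/-- `d̄ = d` for odd `d`, `2d` for even `d`. -/
def dbar (d : ℕ) : ℕ := if d % 2 = 1 then d else 2 * d

/-- `ω = exp(2πi/d)`. -/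
def omega (d : ℕ) : ℂ := Complex.exp (2 * Real.pi * Complex.I / d)

/-- `τ = −exp(πi/d)`. -/
def tau (d : ℕ) : ℂ := -Complex.exp (Real.pi * Complex.I / d)

/-- The diagonal matrix `T e_r = ω^r e_r`. -/
def Tmat (d : ℕ) : Matrix (Fin d) (Fin d) ℂ :=
  Matrix.diagonal fun r => omega d ^ (r : ℕ)

/-- The cyclic shift `S e_r = e_{r+1 mod d}`. -/
def Smat (d : ℕ) : Matrix (Fin d) (Fin d) ℂ :=
  Matrix.of fun r s => if (r : ℕ) = ((s : ℕ) + 1) % d then 1 else 0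

/-- The displacement operators `D_p = τ^{p₁p₂} S^{p₁} T^{p₂}`. -/
def Dmat (d : ℕ) (p : ℤ × ℤ) : Matrix (Fin d) (Fin d) ℂ :=
  tau d ^ (p.1 * p.2) • (Smat d ^ p.1 * Tmat d ^ p.2)

/-- The symplectic form `⟨p,q⟩ = p₂q₁ − p₁q₂`. -/
def symp (p q : ℤ × ℤ) : ℤ := p.2 * q.1 - p.1 * q.2

/-- Action of a 2×2 integer matrix on `ℤ²`. -/
def Fapp (F : Matrix (Fin 2) (Fin 2) ℤ) (p : ℤ × ℤ) : ℤ × ℤ :=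
  (F 0 0 * p.1 + F 0 1 * p.2, F 1 0 * p.1 + F 1 1 * p.2)

/-- The generalized Pauli group `W(d) = {e^{iξ} D_p}`, as a set of matrices. -/
def Wset (d : ℕ) : Set (Matrix (Fin d) (Fin d) ℂ) :=
  {M | ∃ ξ : ℝ, ∃ p : ℤ × ℤ, M = Complex.exp (ξ * Complex.I) • Dmat d p}

section Weyl

variable {G : Type*} [Group G]

/-- The abstract displacement `z ^ (p₁ p₂) s ^ p₁ t ^ p₂` in a group. -/
def weyl (z s t : G) (p : ℤ × ℤ) : G := z ^ (p.1 * p.2) * (s ^ p.1 * t ^ p.2)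

variable {z s t : G}

theorem zpow_mul_zpow_of_central (hz : ∀ g, Commute z g) (h : t * s = z ^ 2 * (s * t))
    (a b : ℤ) : t ^ a * s ^ b = z ^ (2 * (a * b)) * (s ^ b * t ^ a) := by
  have h1 : t * s * t⁻¹ = z ^ 2 * s := by rw [h]; group
  have h2 : t * s ^ b * t⁻¹ = z ^ (2 * b) * s ^ b := by
    rw [← conj_zpow, h1, ((hz s).pow_left 2).mul_zpow, ← zpow_natCast z 2, ← _root_.zpow_mul]; rfl
  have h3 : (s ^ b)⁻¹ * t * (s ^ b)⁻¹⁻¹ = z ^ (2 * b) * t := by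
    have h4 : t * s ^ b = z ^ (2 * b) * s ^ b * t := by rw [← h2]; group
    have h5 := (((hz (s ^ b)).zpow_left (2 * b)).eq)
    rw [inv_inv, mul_assoc, h4, h5]; group
  have h6 : (s ^ b)⁻¹ * t ^ a * (s ^ b)⁻¹⁻¹ = z ^ (2 * (a * b)) * t ^ a := by
    rw [← conj_zpow, h3, ((hz t).zpow_left _).mul_zpow, ← _root_.zpow_mul]
    congr 2; ring
  have h7 := (((hz (s ^ b)).zpow_left (2 * (a * b))).eq)
  rw [← mul_assoc, h7, mul_assoc, ← h6]; group

theorem weyl_mul (hz : ∀ g, Commute z g) (h : t * s = z ^ 2 * (s * t)) (p q : ℤ × ℤ) :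
    weyl z s t p * weyl z s t q = z ^ symp p q * weyl z s t (p + q) := by
  have hc : ∀ (n : ℤ) (g : G), g * z ^ n = z ^ n * g := fun n g => ((hz g).zpow_left n).eq.symm
  unfold weyl symp
  calc _ = z ^ (p.1 * p.2) * ((s ^ p.1 * t ^ p.2) * z ^ (q.1 * q.2)) * (s ^ q.1 * t ^ q.2) := by
        group
    _ = z ^ (p.1 * p.2) * z ^ (q.1 * q.2) * s ^ p.1 * (t ^ p.2 * s ^ q.1) * t ^ q.2 := by
        rw [hc]; simp only [mul_assoc]
    _ = z ^ (p.1 * p.2) * z ^ (q.1 * q.2) * (s ^ p.1 * z ^ (2 * (p.2 * q.1)))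
          * s ^ q.1 * t ^ p.2 * t ^ q.2 := by
        rw [zpow_mul_zpow_of_central hz h]; simp only [mul_assoc]
    _ = (z ^ (p.1 * p.2) * z ^ (q.1 * q.2) * z ^ (2 * (p.2 * q.1))) *
          ((s ^ p.1 * s ^ q.1) * (t ^ p.2 * t ^ q.2)) := by
        rw [hc _ (s ^ p.1)]; simp only [mul_assoc]
    _ = _ := by
        simp only [← _root_.zpow_add, ← mul_assoc, Prod.fst_add, Prod.snd_add]
        congr 3; ring

theorem weyl_zpow (hz : ∀ g, Commute z g) (h : t * s = z ^ 2 * (s * t)) (p : ℤ × ℤ) (n : ℤ) :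
    weyl z s t p ^ n = weyl z s t (n * p.1, n * p.2) := by
  have key : ∀ m : ℤ, weyl z s t p * weyl z s t (m * p.1, m * p.2) =
      weyl z s t ((m + 1) * p.1, (m + 1) * p.2) := fun m => by
    rw [weyl_mul hz h, show symp p (m * p.1, m * p.2) = 0 by simp only [symp]; ring, zpow_zero,
      one_mul]
    congr 1; ext <;> simp only [Prod.fst_add, Prod.snd_add] <;> ring
  induction n using Int.induction_on with
  | zero => simp [weyl]
  | succ m ih => rw [add_comm, _root_.zpow_add, zpow_one, ih, key, add_comm]
  | pred m ih =>
    have := key (-m - 1)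
    rw [sub_add_cancel, ← ih] at this
    rw [sub_eq_neg_add, _root_.zpow_add, ← this]; simp [sub_eq_neg_add]

theorem weyl_natCast_smul {d : ℕ} (hzd : z ^ (d * d) = 1) (hs : s ^ d = 1) (ht : t ^ d = 1)
    (q : ℤ × ℤ) : weyl z s t (d * q.1, d * q.2) = 1 := by
  have hzd' : z ^ ((d : ℤ) * d) = 1 := by exact_mod_cast hzd
  have e : (d * q.1 * (d * q.2) : ℤ) = d * d * (q.1 * q.2) := by ring
  simp only [weyl, e]
  rw [_root_.zpow_mul, hzd', _root_.zpow_mul s, _root_.zpow_mul t]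
  simp [hs, ht]

/-- A homomorphism fixing `z` acts on displacements through its values on the generators. -/
theorem map_weyl (hz : ∀ g, Commute z g) (h : t * s = z ^ 2 * (s * t)) (φ : G →* G)
    (hφ : φ z = z) {a b : ℤ × ℤ} {m n : ℤ} (hs : φ s = z ^ m * weyl z s t a)
    (ht : φ t = z ^ n * weyl z s t b) (p : ℤ × ℤ) :
    φ (weyl z s t p) = z ^ (p.1 * p.2 * (1 + symp a b) + (m * p.1 + n * p.2)) *
      weyl z s t (a.1 * p.1 + b.1 * p.2, a.2 * p.1 + b.2 * p.2) := by
  have hc : ∀ (n : ℤ) (g : G), g * z ^ n = z ^ n * g := fun n g => ((hz g).zpow_left n).eq.symm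
  conv_lhs => unfold weyl
  rw [map_mul, map_mul, map_zpow, map_zpow, map_zpow, hφ, hs, ht,
    ((hz _).zpow_left _).mul_zpow, ((hz _).zpow_left _).mul_zpow, weyl_zpow hz h, weyl_zpow hz h,
    ← _root_.zpow_mul, ← _root_.zpow_mul]
  calc _ = z ^ (p.1 * p.2) * z ^ (m * p.1) * (weyl z s t (p.1 * a.1, p.1 * a.2) * z ^ (n * p.2)) *
        weyl z s t (p.2 * b.1, p.2 * b.2) := by simp only [mul_assoc]
    _ = z ^ (p.1 * p.2) * z ^ (m * p.1) * z ^ (n * p.2) * (weyl z s t (p.1 * a.1, p.1 * a.2) *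
        weyl z s t (p.2 * b.1, p.2 * b.2)) := by rw [hc (n * p.2)]; simp only [mul_assoc]
    _ = _ := by
      rw [weyl_mul hz h, ← mul_assoc, ← _root_.zpow_add, ← _root_.zpow_add, ← _root_.zpow_add]
      congr 2
      · simp only [symp]; ring
      · ext <;> simp only [Prod.fst_add, Prod.snd_add] <;> ring

/-- If a homomorphism fixing `z` maps `s`, `t` to central multiples of displacements at
`a`, `b`, then the commutation relation of `s` and `t` pins down the symplectic form of `a`, `b`. -/
theorem zpow_symp_of_map (hz : ∀ g, Commute z g) (h : t * s = z ^ 2 * (s * t)) (φ : G →* G)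
    (hφ : φ z = z) {a b : ℤ × ℤ} {x y : G} (hx : ∀ g, Commute x g) (hy : ∀ g, Commute y g)
    (hs : φ s = x * weyl z s t a) (ht : φ t = y * weyl z s t b) :
    z ^ (2 * (symp b a - 1)) = 1 := by
  have h1 := congrArg φ h
  rw [map_mul, map_mul, map_mul, map_pow, hφ, hs, ht] at h1
  have e1 : y * weyl z s t b * (x * weyl z s t a) =
      (x * y) * z ^ symp b a * weyl z s t (a + b) := by
    rw [mul_assoc, ← mul_assoc _ x, ← (hx _).eq, mul_assoc, weyl_mul hz h, add_comm b a,
      ← mul_assoc, ← (hx y).eq, mul_assoc, mul_assoc, mul_assoc]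
  have e2 : z ^ 2 * (x * weyl z s t a * (y * weyl z s t b)) =
      (x * y) * z ^ (2 + symp a b) * weyl z s t (a + b) := by
    rw [mul_assoc x, ← mul_assoc _ y, ← (hy _).eq, mul_assoc y, weyl_mul hz h, _root_.zpow_add,
      ← mul_assoc, ← mul_assoc, ((hz x).pow_left 2).eq, mul_assoc x, ((hz y).pow_left 2).eq]
    simp only [mul_assoc, zpow_ofNat]
  rw [e1, e2] at h1
  have h2 := mul_left_cancel (mul_right_cancel h1)
  have e3 : 2 * (symp b a - 1) = symp b a - (2 + symp a b) := by simp only [symp]; ring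
  rw [e3, _root_.zpow_sub, h2, mul_inv_cancel]

end Weyl

/-- A determinant congruent to `1` modulo `d` can be made congruent to `1` modulo `d̄` by
shifting the second column by multiples of `d`. -/
theorem exists_shift_det_modEq_dbar (d : ℕ) (a b : ℤ × ℤ)
    (h : (d : ℤ) ∣ symp b a - 1) :
    ∃ q : ℤ × ℤ, (dbar d : ℤ) ∣ symp (b.1 + d * q.1, b.2 + d * q.2) a - 1 := by
  obtain ⟨k, hk⟩ := h
  unfold symp at *
  unfold dbar
  split_ifs with hodd
  · exact ⟨0, k, by simpa using hk⟩
  · obtain ⟨e, he⟩ : ∃ e, d = 2 * e := ⟨d / 2, by omega⟩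
    rcases Int.even_or_odd' k with ⟨j, rfl | rfl⟩
    · exact ⟨0, j, by push_cast; simp only [Prod.fst_zero, Prod.snd_zero]; linear_combination hk⟩
    · rcases Int.even_or_odd' a.1 with ⟨i, hi | hi⟩
      · rcases Int.even_or_odd' a.2 with ⟨l, hl | hl⟩
        · exfalso
          rw [hi, hl, he] at hk
          have : 2 * (b.2 * i - b.1 * l - e * (2 * j + 1)) = 1 := by
            push_cast at hk; linear_combination hk
          omega
        · refine ⟨(1, 0), j - l, ?_⟩
          push_cast
          linear_combination hk - d * hl
      · refine ⟨(0, 1), j + i + 1, ?_⟩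
        push_cast
        linear_combination hk + d * hi

theorem tau_sq (d : ℕ) : tau d ^ 2 = omega d := by
  rw [tau, omega, neg_sq, ← Complex.exp_nat_mul]
  congr 1; push_cast; ring

theorem tau_pow_dbar {d : ℕ} (hd : d ≠ 0) : tau d ^ dbar d = 1 := by
  have hd' : (d : ℂ) ≠ 0 := by exact_mod_cast hd
  have h : Complex.exp (Real.pi * Complex.I / d) ^ d = -1 := by
    rw [← Complex.exp_nat_mul, mul_div_cancel₀ _ hd', Complex.exp_pi_mul_I]
  unfold dbar tau
  split_ifs with hodd
  · rw [neg_pow, h, (Nat.odd_iff.mpr hodd).neg_one_pow]; norm_num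
  · rw [mul_comm 2 d, pow_mul, neg_pow, h, (Nat.not_odd_iff_even.mp
      (mt Nat.odd_iff.mp hodd)).neg_one_pow]
    norm_num

theorem dbar_dvd_mul_self (d : ℕ) : dbar d ∣ d * d := by
  unfold dbar
  split_ifs with hodd
  · exact dvd_mul_right d d
  · exact mul_dvd_mul_right (by omega) d

theorem omega_isPrimitiveRoot {d : ℕ} (hd : d ≠ 0) : IsPrimitiveRoot (omega d) d :=
  Complex.isPrimitiveRoot_exp d hd

theorem Tmat_pow_self {d : ℕ} (hd : d ≠ 0) : Tmat d ^ d = 1 := by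
  rw [Tmat, Matrix.diagonal_pow, ← Matrix.diagonal_one]
  congr 1; ext r
  simp [← pow_mul, mul_comm (r : ℕ) d, pow_mul _ d, (omega_isPrimitiveRoot hd).pow_eq_one]

theorem Smat_pow_apply {d : ℕ} (n : ℕ) (r s : Fin d) :
    (Smat d ^ n) r s = if (r : ℕ) = (s + n) % d then 1 else 0 := by
  induction n generalizing r with
  | zero => simp [Matrix.one_apply, Fin.ext_iff, Nat.mod_eq_of_lt s.2]
  | succ n ih =>
    have hd : 0 < d := s.pos
    rw [pow_succ', Matrix.mul_apply, Finset.sum_eq_single ⟨(s + n) % d, Nat.mod_lt _ hd⟩]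
    · rw [ih]; simp [Smat, add_assoc]
    · intro x _ hx
      rw [ih, if_neg (fun h => hx (Fin.ext h)), mul_zero]
    · simp

theorem Smat_pow_self (d : ℕ) : Smat d ^ d = 1 := by
  ext r s
  rw [Smat_pow_apply, Matrix.one_apply]
  simp [Nat.mod_eq_of_lt s.2, Fin.ext_iff]

theorem Tmat_mul_Smat {d : ℕ} (hd : d ≠ 0) : Tmat d * Smat d = omega d • (Smat d * Tmat d) := by
  ext r s
  rw [Tmat, Matrix.diagonal_mul, Matrix.smul_apply, Matrix.mul_diagonal]
  by_cases h : (r : ℕ) = (s + 1) % d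
  · have : omega d ^ ((s + 1 : ℕ) % d) = omega d ^ ((s : ℕ) + 1) :=
      (pow_eq_pow_mod _ (omega_isPrimitiveRoot hd).pow_eq_one).symm
    simp [Smat, h, this, pow_succ']
  · simp [Smat, h]

/-- Nonzero scalars as invertible matrices. -/
def scalarUnit (d : ℕ) : ℂˣ →* (Matrix (Fin d) (Fin d) ℂ)ˣ :=
  Units.map (algebraMap ℂ (Matrix (Fin d) (Fin d) ℂ)).toMonoidHom

theorem coe_scalarUnit_mul {d : ℕ} (c : ℂˣ) (g : (Matrix (Fin d) (Fin d) ℂ)ˣ) :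
    ((scalarUnit d c * g : (Matrix (Fin d) (Fin d) ℂ)ˣ) : Matrix (Fin d) (Fin d) ℂ) =
      (c : ℂ) • (g : Matrix (Fin d) (Fin d) ℂ) := by
  rw [Algebra.smul_def]; rfl

theorem scalarUnit_commute {d : ℕ} (c : ℂˣ) (g : (Matrix (Fin d) (Fin d) ℂ)ˣ) :
    Commute (scalarUnit d c) g :=
  Units.ext (Algebra.commutes (c : ℂ) (g : Matrix (Fin d) (Fin d) ℂ))

theorem scalarUnit_injective {d : ℕ} (hd : d ≠ 0) : Function.Injective (scalarUnit d) := by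
  have : NeZero d := ⟨hd⟩
  exact Units.map_injective (algebraMap ℂ (Matrix (Fin d) (Fin d) ℂ)).injective

/-- If a unitary `U` normalizes the generalized Pauli group `W(d)`,
then there are an integer matrix `F` with `det F ≡ 1 (mod d̄)` and `χ ∈ ℤ²` with
`U D_p U† = ω^{⟨χ,Fp⟩} D_{Fp}` for all `p ∈ ℤ²`. -/
theorem stmt0 (d : ℕ) (hd : 2 ≤ d) (U : Matrix (Fin d) (Fin d) ℂ)
    (hU : U ∈ Matrix.unitaryGroup (Fin d) ℂ)
    (hnorm : (fun M => U * M * Uᴴ) '' Wset d = Wset d) :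
    ∃ F : Matrix (Fin 2) (Fin 2) ℤ, ∃ χ : ℤ × ℤ,
      F.det ≡ 1 [ZMOD (dbar d)] ∧
      ∀ p : ℤ × ℤ,
        U * Dmat d p * Uᴴ =
          omega d ^ symp χ (Fapp F p) • Dmat d (Fapp F p) := by
  have hd0 : d ≠ 0 := by omega
  have hτ0 : tau d ≠ 0 := neg_ne_zero.mpr (Complex.exp_ne_zero _)
  have hω0 : omega d ≠ 0 := Complex.exp_ne_zero _
  set τ : ℂˣ := Units.mk0 (tau d) hτ0
  set z := scalarUnit d τ with hz_def
  set s : (Matrix (Fin d) (Fin d) ℂ)ˣ := Units.ofPowEqOne _ d (Smat_pow_self d) hd0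
  set t : (Matrix (Fin d) (Fin d) ℂ)ˣ := Units.ofPowEqOne _ d (Tmat_pow_self hd0) hd0
  set u : (Matrix (Fin d) (Fin d) ℂ)ˣ :=
    ⟨U, Uᴴ, Matrix.mem_unitaryGroup_iff.mp hU, Matrix.mem_unitaryGroup_iff'.mp hU⟩
  have hz : ∀ g, Commute z g := scalarUnit_commute τ
  have hsd : s ^ d = 1 := Units.ext (Smat_pow_self d)
  have htd : t ^ d = 1 := Units.ext (Tmat_pow_self hd0)
  have hτ2 : τ ^ 2 = Units.mk0 (omega d) hω0 := Units.ext (tau_sq d)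
  have hτdbar : τ ^ dbar d = 1 := Units.ext (tau_pow_dbar hd0)
  have hzdbar : z ^ dbar d = 1 := by rw [hz_def, ← map_pow, hτdbar, map_one]
  have hzdd : z ^ (d * d) = 1 := by
    obtain ⟨k, hk⟩ := dbar_dvd_mul_self d
    rw [hk, pow_mul, hzdbar, one_pow]
  have hts : t * s = z ^ 2 * (s * t) := by
    apply Units.ext
    rw [hz_def, ← map_pow, hτ2, coe_scalarUnit_mul]
    exact Tmat_mul_Smat hd0
  have hD : ∀ p, Dmat d p = (weyl z s t p : (Matrix (Fin d) (Fin d) ℂ)ˣ) := fun p => by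
    rw [weyl, hz_def, ← map_zpow, coe_scalarUnit_mul, Units.val_zpow_eq_zpow_val, Units.val_mul,
      Matrix.coe_units_zpow, Matrix.coe_units_zpow]
    rfl
  set φ := (MulAut.conj u).toMonoidHom
  have hφ : ∀ g, φ g = u * g * u⁻¹ := fun g => rfl
  have hφc : ∀ c, φ (scalarUnit d c) = scalarUnit d c := fun c => by
    rw [hφ, ← (scalarUnit_commute c u).eq, mul_inv_cancel_right]
  have hex : ∀ p, ∃ c : ℂˣ, ∃ q, φ (weyl z s t p) = scalarUnit d c * weyl z s t q := fun p => by
    have hmem : U * Dmat d p * Uᴴ ∈ Wset d := by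
      rw [← hnorm]
      exact ⟨_, ⟨0, p, by simp⟩, rfl⟩
    obtain ⟨ξ, q, hq⟩ := hmem
    refine ⟨Units.mk0 _ (Complex.exp_ne_zero (ξ * Complex.I)), q, Units.ext ?_⟩
    rw [coe_scalarUnit_mul, ← hD, Units.val_mk0, ← hq, hD]
    rfl
  have hs : weyl z s t (1, 0) = s := by simp [weyl]
  have ht : weyl z s t (0, 1) = t := by simp [weyl]
  obtain ⟨x, a, hx⟩ := hex (1, 0)
  obtain ⟨y, b, hy⟩ := hex (0, 1)
  rw [hs] at hx
  rw [ht] at hy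
  have hab : (d : ℤ) ∣ symp b a - 1 := by
    have := zpow_symp_of_map hz hts φ (hφc τ) (scalarUnit_commute x) (scalarUnit_commute y) hx hy
    rw [hz_def, ← map_zpow, map_eq_one_iff _ (scalarUnit_injective hd0), _root_.zpow_mul,
      zpow_ofNat, hτ2] at this
    refine ((omega_isPrimitiveRoot hd0).zpow_eq_one_iff_dvd _).mp ?_
    simpa using congrArg Units.val this
  obtain ⟨q, hq⟩ := exists_shift_det_modEq_dbar d a b hab
  set b' : ℤ × ℤ := (b.1 + d * q.1, b.2 + d * q.2)
  obtain ⟨y', hy'⟩ : ∃ y' : ℂˣ, φ t = scalarUnit d y' * weyl z s t b' := by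
    refine ⟨y * τ ^ symp b (d * q.1, d * q.2), ?_⟩
    have h1 := weyl_mul hz hts b (d * q.1, d * q.2)
    rw [weyl_natCast_smul hzdd hsd htd, mul_one] at h1
    rw [hy, h1, map_mul, map_zpow, mul_assoc]
    rfl
  have root : ∀ (g : (Matrix (Fin d) (Fin d) ℂ)ˣ) (c : ℂˣ) (v : ℤ × ℤ), g ^ d = 1 →
      φ g = scalarUnit d c * weyl z s t v → ∃ m : ℤ, scalarUnit d c = z ^ (2 * m) := by
    intro g c v hg hc
    have h1 : weyl z s t v ^ d = 1 := by
      rw [← zpow_natCast, weyl_zpow hz hts, weyl_natCast_smul hzdd hsd htd]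
    have h2 := congrArg (· ^ d) hc
    simp only [← map_pow, hg, map_one, (scalarUnit_commute c _).mul_pow, h1, mul_one] at h2
    have h3 : c ^ d = 1 := (map_eq_one_iff _ (scalarUnit_injective hd0)).mp h2.symm
    have : NeZero d := ⟨hd0⟩
    obtain ⟨m, -, hm⟩ := (omega_isPrimitiveRoot hd0).eq_pow_of_pow_eq_one
      (ξ := (c : ℂ)) (by simpa using congrArg Units.val h3)
    refine ⟨m, ?_⟩
    rw [_root_.zpow_mul, zpow_ofNat, zpow_natCast, hz_def, ← map_pow, ← map_pow, hτ2]
    congr 1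
    exact Units.ext hm.symm
  obtain ⟨m, hm⟩ := root s x a hsd hx
  obtain ⟨n, hn⟩ := root t y' b' htd hy'
  rw [hm] at hx
  rw [hn] at hy'
  obtain ⟨k, hk⟩ := hq
  refine ⟨!![a.1, b'.1; a.2, b'.2], (m * b'.1 - n * a.1, m * b'.2 - n * a.2), ?_, fun p => ?_⟩
  · refine (Int.modEq_iff_dvd.mpr ⟨k, ?_⟩).symm
    rw [← hk, Matrix.det_fin_two_of, symp]; ring
  · have hF : Fapp !![a.1, b'.1; a.2, b'.2] p =
        (a.1 * p.1 + b'.1 * p.2, a.2 * p.1 + b'.2 * p.2) := by simp [Fapp]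
    have hzk : ∀ j : ℤ, z ^ ((dbar d : ℤ) * j) = 1 := fun j => by
      rw [_root_.zpow_mul, zpow_natCast, hzdbar, _root_.one_zpow]
    set w := Fapp !![a.1, b'.1; a.2, b'.2] p
    have hmain := map_weyl hz hts φ (hφc τ) hx hy' p
    rw [← hF] at hmain
    have hexp : p.1 * p.2 * (1 + symp a b') + (2 * m * p.1 + 2 * n * p.2) =
        2 * symp (m * b'.1 - n * a.1, m * b'.2 - n * a.2) w +
          dbar d * (k * (-(p.1 * p.2) - 2 * (m * p.1 + n * p.2))) := by
      rw [hF]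
      simp only [symp] at hk ⊢
      linear_combination (-(p.1 * p.2) - 2 * (m * p.1 + n * p.2)) * hk
    rw [hexp, _root_.zpow_add, hzk, mul_one, _root_.zpow_mul, zpow_ofNat, hz_def, ← map_pow, ← map_zpow,
      hτ2] at hmain
    have := congrArg Units.val hmain
    rw [coe_scalarUnit_mul, ← hz_def, ← hD, Units.val_zpow_eq_zpow_val, Units.val_mk0] at this
    rw [← this, hD, hφ]
    rfl
end
end

section
/- Let d̄ ≥ 2 and let α, β, γ, δ be integers with αδ − βγ ≡ 1 (mod d̄), and suppose the matrix F = [[α,β],[γ,δ]] is non-prime, i.e. it is not the case that both β ≠ 0 and gcd(β, d̄) = 1. Then there exists an integer x such that δ + xβ ≠ 0 and gcd(δ + xβ, d̄) = 1. Moreover, for any such x, setting F₁ = [[0,−1],[1,x]] and F₂ = [[γ+xα, δ+xβ],[−α,−β]], one has F = F₁F₂ as integer matrices, both F₁ and F₂ have determinant ≡ 1 (mod d̄), and both are prime matrices. -/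
noncomputable section

/-- A 2×2 integer matrix (with `det ≡ 1 (mod d̄)`) is *prime* if its upper-right entry
`β` satisfies `β ≠ 0` and `gcd(β, d̄) = 1`. -/
def IsPrimeMat (dbar : ℕ) (F : Matrix (Fin 2) (Fin 2) ℤ) : Prop :=
  F 0 1 ≠ 0 ∧ Int.gcd (F 0 1) dbar = 1

/-- If no prime divisor of `n ≠ 0` divides both `a` and `b`, then some `a + x * b` is coprime
to `n`. -/
theorem exists_gcd_add_mul_eq_one {n : ℕ} (hn : n ≠ 0) {a b : ℤ}
    (h : ∀ p : ℕ, p.Prime → p ∣ n → (p : ℤ) ∣ a → ¬ (p : ℤ) ∣ b) :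
    ∃ x : ℤ, Int.gcd (a + x * b) n = 1 := by
  classical
  refine ⟨∏ p ∈ n.primeFactors with ¬ ((p : ℕ) : ℤ) ∣ a, (p : ℤ), ?_⟩
  set x : ℤ := ∏ p ∈ n.primeFactors with ¬ ((p : ℕ) : ℤ) ∣ a, (p : ℤ)
  by_contra hgcd
  obtain ⟨p, hp, hpg⟩ := Nat.exists_prime_and_dvd hgcd
  have hpn : p ∣ n := hpg.trans (Int.gcd_dvd_natAbs_right _ _)
  have hps : (p : ℤ) ∣ a + x * b := (Int.natCast_dvd_natCast.2 hpg).trans (Int.gcd_dvd_left _ _)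
  by_cases hpa : (p : ℤ) ∣ a
  · have hpx : (p : ℤ) ∣ x :=
      ((Nat.prime_iff_prime_int.1 hp).dvd_or_dvd ((dvd_add_right hpa).1 hps)).resolve_right
        (h p hp hpn hpa)
    obtain ⟨q, hq, hpq⟩ := (Nat.prime_iff_prime_int.1 hp).exists_mem_finset_dvd hpx
    obtain ⟨hqn, hqa⟩ := Finset.mem_filter.1 hq
    have hqp : p = q :=
      (Nat.prime_dvd_prime_iff_eq hp (Nat.prime_of_mem_primeFactors hqn)).1
        (Int.natCast_dvd_natCast.1 hpq)
    exact hqa (hqp ▸ hpa)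
  · have hpx : (p : ℤ) ∣ x :=
      Finset.dvd_prod_of_mem (fun q : ℕ => (q : ℤ))
        (Finset.mem_filter.2 ⟨Nat.mem_primeFactors.2 ⟨hp, hpn, hn⟩, hpa⟩)
    exact hpa ((dvd_add_left (hpx.mul_right b)).1 hps)

/-- Every non-prime matrix `F = [[α,β],[γ,δ]]` with `det ≡ 1 (mod d̄)`
factors as a product `F = F₁F₂` of two prime matrices, with
`F₁ = [[0,−1],[1,x]]` and `F₂ = [[γ+xα, δ+xβ],[−α,−β]]` for a suitable integer `x`
(any `x` with `δ+xβ ≠ 0` and `gcd(δ+xβ, d̄) = 1` works, and such an `x` exists). -/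
theorem stmt2 (dbar : ℕ) (hdbar : 2 ≤ dbar) (α β γ δ : ℤ)
    (hdet : α * δ - β * γ ≡ 1 [ZMOD dbar])
    (hnp : ¬ IsPrimeMat dbar !![α, β; γ, δ]) :
    (∃ x : ℤ, δ + x * β ≠ 0 ∧ Int.gcd (δ + x * β) dbar = 1) ∧
      ∀ x : ℤ, δ + x * β ≠ 0 → Int.gcd (δ + x * β) dbar = 1 →
        (!![0, -1; 1, x] : Matrix (Fin 2) (Fin 2) ℤ) * !![γ + x * α, δ + x * β; -α, -β] =
            !![α, β; γ, δ] ∧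
          (!![0, -1; 1, x] : Matrix (Fin 2) (Fin 2) ℤ).det ≡ 1 [ZMOD dbar] ∧
          (!![γ + x * α, δ + x * β; -α, -β] : Matrix (Fin 2) (Fin 2) ℤ).det ≡ 1 [ZMOD dbar] ∧
          IsPrimeMat dbar !![0, -1; 1, x] ∧
          IsPrimeMat dbar !![γ + x * α, δ + x * β; -α, -β] := by
  refine ⟨?_, fun x hx hgcd => ⟨?_, ?_, ?_, ?_, ?_⟩⟩
  · obtain ⟨x, hx⟩ := exists_gcd_add_mul_eq_one (n := dbar) (a := δ) (b := β) (by omega) <| by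
      intro p hp hpn hpδ hpβ
      have hdvd : (p : ℤ) ∣ 1 - (α * δ - β * γ) :=
        (Int.natCast_dvd_natCast.2 hpn).trans hdet.dvd
      exact (Nat.prime_iff_prime_int.1 hp).not_dvd_one
        ((dvd_sub_left ((hpδ.mul_left α).sub (hpβ.mul_right γ))).1 hdvd)
    refine ⟨x, fun h0 => ?_, hx⟩
    rw [h0, Int.gcd_zero_left, Int.natAbs_natCast] at hx
    omega
  · ext i j
    fin_cases i <;> fin_cases j <;> simp
  · simp [Matrix.det_fin_two]
  · rw [Matrix.det_fin_two_of]
    convert hdet using 1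
    ring
  · simp [IsPrimeMat]
  · simpa [IsPrimeMat] using ⟨hx, hgcd⟩
end
end
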